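/- arXiv:2202.13311 — 10 statements merged into one kernel-verified Lean document; each statement's English description precedes it below -/
import Mathlib

section
/- Let α be a finite type, let P and Q be probability mass functions on α with Q absolutely continuous with respect to P (i.e., P(x) = 0 implies Q(x) = 0), and let f : α → ℝ be an observable. Write Var_P[f] for the variance of f under P, E_P and E_Q for expectations, and E_P[(Q/P)²] = Σ_{x : P(x)>0} Q(x)²/P(x). Then Var_P[f] · (E_P[(Q/P)²] − 1) ≥ (E_Q[f] − E_P[f])². -/
open Finset

/-- The generalized thermodynamic uncertainty relation (γ = 1 case):
for PMFs `P`, `Q` on a finite type with `Q ≪ P`, and any observable `f`,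
`Var_P[f] · (E_P[(Q/P)²] − 1) ≥ (E_Q[f] − E_P[f])²`. -/
theorem generalized_TUR {α : Type*} [Fintype α] (P Q : α → ℝ) (f : α → ℝ)
    (hP0 : ∀ x, 0 ≤ P x) (hP1 : ∑ x, P x = 1)
    (hQ0 : ∀ x, 0 ≤ Q x) (hQ1 : ∑ x, Q x = 1)
    (hac : ∀ x, P x = 0 → Q x = 0) :
    ((∑ x, P x * (f x) ^ 2) - (∑ x, P x * f x) ^ 2) *
      ((∑ x ∈ univ.filter (fun x => 0 < P x), (Q x) ^ 2 / P x) - 1) ≥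
      ((∑ x, Q x * f x) - (∑ x, P x * f x)) ^ 2 := by
  have hfilter : ∑ x ∈ univ.filter (fun x => 0 < P x), (Q x) ^ 2 / P x = ∑ x, (Q x) ^ 2 / P x := by
    refine sum_filter_of_ne fun x _ hx => (hP0 x).lt_of_ne' fun h => hx ?_
    simp [h]
  set m := ∑ x, P x * f x with hm
  have hvar : ∑ x, P x * (f x - m) ^ 2 = (∑ x, P x * (f x) ^ 2) - m ^ 2 := by
    have hexpand : ∀ x, P x * (f x - m) ^ 2 =
        P x * (f x) ^ 2 - 2 * m * (P x * f x) + m ^ 2 * P x := fun x => by ring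
    simp only [hexpand, sum_add_distrib, sum_sub_distrib, ← mul_sum, ← hm, hP1]
    ring
  have hchi : ∑ x, (Q x - P x) ^ 2 / P x = (∑ x, (Q x) ^ 2 / P x) - 1 := by
    have hexpand : ∀ x, (Q x - P x) ^ 2 / P x = (Q x) ^ 2 / P x - 2 * Q x + P x := fun x => by
      rcases eq_or_ne (P x) 0 with h | h
      · simp [h, hac x h]
      · field_simp
        ring
    simp only [hexpand, sum_add_distrib, sum_sub_distrib, ← mul_sum, hP1, hQ1]
    ring
  have hcov : ∑ x, (Q x - P x) * (f x - m) = (∑ x, Q x * f x) - m := by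
    have hexpand : ∀ x, (Q x - P x) * (f x - m) =
        Q x * f x - P x * f x - m * Q x + m * P x := fun x => by ring
    simp only [hexpand, sum_add_distrib, sum_sub_distrib, ← mul_sum, ← hm, hP1, hQ1]
    ring
  rw [hfilter, ← hvar, ← hchi, ← hcov]
  refine sum_sq_le_sum_mul_sum_of_sq_le_mul univ
    (fun x _ => mul_nonneg (hP0 x) (sq_nonneg _))
    (fun x _ => div_nonneg (sq_nonneg _) (hP0 x)) fun x _ => le_of_eq ?_
  rcases eq_or_ne (P x) 0 with h | h
  · simp [h, hac x h]
  · field_simp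
end

section
/- Let α be a finite type, let P and Q be probability mass functions on α (no absolute continuity assumed), and let f : α → ℝ. Define γ = Σ_{x : P(x)>0} Q(x), the Q-probability of the support of P, and assume γ > 0. Define E_P[(Q/P)²] = Σ_{x : P(x)>0} Q(x)²/P(x) and the restricted mean ⟨f⟩_{Q:P>0} = (1/γ) Σ_{x : P(x)>0} Q(x) f(x). Then Var_P[f] · (E_P[(Q/P)²] − γ²) ≥ γ² · (⟨f⟩_{Q:P>0} − E_P[f])². -/
open Finset

/-- The general TUR without absolute continuity (inequality (10) of the paper),
in product form: with `γ = Σ_{P(x)>0} Q(x) > 0`,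
`Var_P[f] · (E_P[(Q/P)²] − γ²) ≥ γ² · (⟨f⟩_{Q:P>0} − E_P[f])²`. -/
theorem general_TUR {α : Type*} [Fintype α] (P Q : α → ℝ) (f : α → ℝ)
    (hP0 : ∀ x, 0 ≤ P x) (hP1 : ∑ x, P x = 1)
    (hQ0 : ∀ x, 0 ≤ Q x) (hQ1 : ∑ x, Q x = 1)
    (hγ : 0 < ∑ x ∈ univ.filter (fun x => 0 < P x), Q x) :
    ((∑ x, P x * (f x) ^ 2) - (∑ x, P x * f x) ^ 2) *
      ((∑ x ∈ univ.filter (fun x => 0 < P x), (Q x) ^ 2 / P x) -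
        (∑ x ∈ univ.filter (fun x => 0 < P x), Q x) ^ 2) ≥
      (∑ x ∈ univ.filter (fun x => 0 < P x), Q x) ^ 2 *
        ((1 / ∑ x ∈ univ.filter (fun x => 0 < P x), Q x) *
          (∑ x ∈ univ.filter (fun x => 0 < P x), Q x * f x) -
            (∑ x, P x * f x)) ^ 2 := by
  have hsum (g : α → ℝ) : ∑ x, P x * g x = ∑ x ∈ univ.filter (fun x => 0 < P x), P x * g x := by
    refine (sum_filter_of_ne fun x _ hx => ?_).symm
    exact (hP0 x).lt_of_ne' (left_ne_zero_of_mul hx)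
  have hone : ∑ x ∈ univ.filter (fun x => 0 < P x), P x = 1 := by
    simpa [hP1] using (hsum fun _ => 1).symm
  rw [hsum (fun x => f x ^ 2), hsum f]
  have hpos : ∀ x ∈ univ.filter (fun x => 0 < P x), 0 < P x := fun x hx => (mem_filter.mp hx).2
  generalize univ.filter (fun x => 0 < P x) = S at *
  set γ := ∑ x ∈ S, Q x with hγ_def
  set m := ∑ x ∈ S, P x * f x with hm_def
  have hcs := sum_sq_le_sum_mul_sum_of_sq_le_mul S
    (r := fun x => (f x - m) * (Q x - γ * P x))
    (f := fun x => P x * (f x - m) ^ 2) (g := fun x => (Q x - γ * P x) ^ 2 / P x)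
    (fun x hx => mul_nonneg (hpos x hx).le (sq_nonneg _))
    (fun x hx => div_nonneg (sq_nonneg _) (hpos x hx).le)
    (fun x hx => le_of_eq (by have := (hpos x hx).ne'; field_simp))
  have hvar : ∑ x ∈ S, P x * (f x - m) ^ 2 = ∑ x ∈ S, P x * f x ^ 2 - m ^ 2 := by
    calc ∑ x ∈ S, P x * (f x - m) ^ 2
        = ∑ x ∈ S, (P x * f x ^ 2 - 2 * m * (P x * f x) + m ^ 2 * P x) :=
          sum_congr rfl fun x _ => by ring
      _ = ∑ x ∈ S, P x * f x ^ 2 - m ^ 2 := by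
          rw [sum_add_distrib, sum_sub_distrib, ← mul_sum, ← mul_sum, hone, ← hm_def]
          ring
  have hchi : ∑ x ∈ S, (Q x - γ * P x) ^ 2 / P x = ∑ x ∈ S, Q x ^ 2 / P x - γ ^ 2 := by
    calc ∑ x ∈ S, (Q x - γ * P x) ^ 2 / P x
        = ∑ x ∈ S, (Q x ^ 2 / P x - 2 * γ * Q x + γ ^ 2 * P x) :=
          sum_congr rfl fun x hx => by have := (hpos x hx).ne'; field_simp; ring
      _ = ∑ x ∈ S, Q x ^ 2 / P x - γ ^ 2 := by
          rw [sum_add_distrib, sum_sub_distrib, ← mul_sum, ← mul_sum, hone, ← hγ_def]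
          ring
  have hcov : ∑ x ∈ S, (f x - m) * (Q x - γ * P x) = ∑ x ∈ S, Q x * f x - γ * m := by
    calc ∑ x ∈ S, (f x - m) * (Q x - γ * P x)
        = ∑ x ∈ S, (Q x * f x - m * Q x - γ * (P x * f x) + γ * m * P x) :=
          sum_congr rfl fun x _ => by ring
      _ = ∑ x ∈ S, Q x * f x - γ * m := by
          rw [sum_add_distrib, sum_sub_distrib, sum_sub_distrib, ← mul_sum, ← mul_sum,
            ← mul_sum, hone, ← hγ_def, ← hm_def]
          ring
  rw [hvar, hchi, hcov] at hcs
  have hrhs : γ ^ 2 * (1 / γ * ∑ x ∈ S, Q x * f x - m) ^ 2 =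
      (∑ x ∈ S, Q x * f x - γ * m) ^ 2 := by
    rw [← mul_pow, mul_sub, ← mul_assoc, mul_one_div_cancel hγ.ne', one_mul]
  rw [ge_iff_le, hrhs]
  exact hcs
end

section
/- Let α be a finite type, let P be a probability mass function on α, and let f : α → ℝ satisfy f(x) ≥ 0 for every x with P(x) > 0, and suppose Z := E_P[f] > 0. Define Q(x) = f(x) P(x) / Z. Then Q is a probability mass function absolutely continuous with respect to P, and equality holds in the generalized TUR: Var_P[f] · (E_P[(Q/P)²] − 1) = (E_Q[f] − E_P[f])². -/
open Finset

/-- Optimality of the generalized TUR for nonnegative observables: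
for a PMF `P` and `f ≥ 0` on the support of `P` with `Z = E_P[f] > 0`,
the tilted distribution `Q = fP/Z` is a PMF absolutely continuous w.r.t. `P`
which attains equality in the generalized TUR. -/
theorem TUR_optimality_nonneg {α : Type*} [Fintype α] (P : α → ℝ) (f : α → ℝ)
    (hP0 : ∀ x, 0 ≤ P x) (hP1 : ∑ x, P x = 1)
    (hf : ∀ x, 0 < P x → 0 ≤ f x)
    (hZ : 0 < ∑ x, P x * f x) :
    (∀ x, 0 ≤ f x * P x / (∑ y, P y * f y)) ∧
    (∑ x, f x * P x / (∑ y, P y * f y)) = 1 ∧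
    (∀ x, P x = 0 → f x * P x / (∑ y, P y * f y) = 0) ∧
    ((∑ x, P x * (f x) ^ 2) - (∑ x, P x * f x) ^ 2) *
      ((∑ x ∈ univ.filter (fun x => 0 < P x),
          (f x * P x / (∑ y, P y * f y)) ^ 2 / P x) - 1) =
      ((∑ x, (f x * P x / (∑ y, P y * f y)) * f x) - (∑ x, P x * f x)) ^ 2 := by
  set Z := ∑ y, P y * f y with hZdef
  have hZ0 : Z ≠ 0 := hZ.ne'
  have hchi : (∑ x ∈ univ.filter (fun x => 0 < P x), (f x * P x / Z) ^ 2 / P x) =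
      (∑ x, P x * (f x) ^ 2) / Z ^ 2 := by
    rw [Finset.sum_filter, Finset.sum_div]
    refine Finset.sum_congr rfl fun x _ => ?_
    split_ifs with hx
    · have hPx : P x ≠ 0 := hx.ne'
      field_simp
    · simp [le_antisymm (not_lt.mp hx) (hP0 x)]
  have hmean : (∑ x, (f x * P x / Z) * f x) = (∑ x, P x * (f x) ^ 2) / Z := by
    rw [Finset.sum_div]
    exact Finset.sum_congr rfl fun x _ => by ring
  refine ⟨fun x => ?_, ?_, fun x hx => by simp [hx], ?_⟩
  · rcases (hP0 x).eq_or_lt with hx | hx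
    · simp [← hx]
    · exact div_nonneg (mul_nonneg (hf x hx) hx.le) hZ.le
  · rw [← Finset.sum_div, div_eq_one_iff_eq hZ0, hZdef]
    exact Finset.sum_congr rfl fun x _ => mul_comm _ _
  · rw [hchi, hmean]
    field_simp
end

section
/- Let α be a finite type, let P be a probability mass function on α, and let f : α → ℝ satisfy f(x) ≤ 0 for every x with P(x) > 0, and suppose E_P[f] < 0. Then there exists a probability mass function Q on α, absolutely continuous with respect to P, such that equality holds in the generalized TUR: Var_P[f] · (E_P[(Q/P)²] − 1) = (E_Q[f] − E_P[f])². -/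
open Finset

/-- Optimality of the generalized TUR for nonpositive observables:
for a PMF `P` and `f ≤ 0` on the support of `P` with `E_P[f] < 0`,
there exists a PMF `Q` absolutely continuous w.r.t. `P` attaining
equality in the generalized TUR. -/
theorem TUR_optimality_nonpos {α : Type*} [Fintype α] (P : α → ℝ) (f : α → ℝ)
    (hP0 : ∀ x, 0 ≤ P x) (hP1 : ∑ x, P x = 1)
    (hf : ∀ x, 0 < P x → f x ≤ 0)
    (hE : (∑ x, P x * f x) < 0) :
    ∃ Q : α → ℝ, (∀ x, 0 ≤ Q x) ∧ (∑ x, Q x = 1) ∧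
      (∀ x, P x = 0 → Q x = 0) ∧
      ((∑ x, P x * (f x) ^ 2) - (∑ x, P x * f x) ^ 2) *
        ((∑ x ∈ univ.filter (fun x => 0 < P x), (Q x) ^ 2 / P x) - 1) =
        ((∑ x, Q x * f x) - (∑ x, P x * f x)) ^ 2 := by
  have hm : (∑ x, P x * f x) ≠ 0 := hE.ne
  have h_ratio : (∑ x ∈ univ.filter (fun x => 0 < P x),
      (P x * f x / ∑ y, P y * f y) ^ 2 / P x) =
      (∑ x, P x * (f x) ^ 2) / (∑ y, P y * f y) ^ 2 := by
    rw [Finset.sum_filter, Finset.sum_div]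
    refine Finset.sum_congr rfl fun x _ => ?_
    split_ifs with h
    · have := h.ne'
      field_simp
    · have : P x = 0 := le_antisymm (not_lt.mp h) (hP0 x)
      simp [this]
  have h_mean : (∑ x, P x * f x / (∑ y, P y * f y) * f x) =
      (∑ x, P x * (f x) ^ 2) / ∑ y, P y * f y := by
    rw [Finset.sum_div]
    exact Finset.sum_congr rfl fun x _ => by ring
  refine ⟨fun x => P x * f x / ∑ y, P y * f y, fun x => ?_, ?_, fun x hx => ?_, ?_⟩
  · refine div_nonneg_of_nonpos ?_ hE.le
    rcases (hP0 x).eq_or_lt with h | h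
    · simp [← h]
    · exact mul_nonpos_of_nonneg_of_nonpos h.le (hf x h)
  · rw [← Finset.sum_div, div_self hm]
  · simp [hx]
  · simp only [h_ratio, h_mean]
    field_simp
end

section
/- Let α be a finite type, let P be a probability mass function on α, let f : α → ℝ, and let m ∈ ℝ satisfy f(x) ≥ m for every x with P(x) > 0, with f not P-almost-surely equal to m (i.e., E_P[f] > m). Then there exists a probability mass function Q on α, absolutely continuous with respect to P, such that Var_P[f] · (E_P[(Q/P)²] − 1) = (E_Q[f] − E_P[f])². -/
open Finset

/-- Corollary of the optimality theorem: the generalized TUR is tight for any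
observable bounded from below on the support of `P` (and not a.s. equal to its
lower bound): there is a PMF `Q ≪ P` attaining equality. -/
theorem TUR_optimality_bounded_below {α : Type*} [Fintype α] (P : α → ℝ) (f : α → ℝ)
    (m : ℝ)
    (hP0 : ∀ x, 0 ≤ P x) (hP1 : ∑ x, P x = 1)
    (hf : ∀ x, 0 < P x → m ≤ f x)
    (hE : m < ∑ x, P x * f x) :
    ∃ Q : α → ℝ, (∀ x, 0 ≤ Q x) ∧ (∑ x, Q x = 1) ∧
      (∀ x, P x = 0 → Q x = 0) ∧
      ((∑ x, P x * (f x) ^ 2) - (∑ x, P x * f x) ^ 2) *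
        ((∑ x ∈ univ.filter (fun x => 0 < P x), (Q x) ^ 2 / P x) - 1) =
        ((∑ x, Q x * f x) - (∑ x, P x * f x)) ^ 2 := by
  have hμ : 0 < (∑ x, P x * f x) - m := sub_pos.2 hE
  have hμ0 := hμ.ne'
  have hQ1 : ∑ x, P x * (f x - m) = (∑ x, P x * f x) - m := by
    simp only [mul_sub, sum_sub_distrib, ← sum_mul, hP1, one_mul]
  have hQf : ∑ x, P x * (f x - m) * f x =
      (∑ x, P x * (f x) ^ 2) - m * ∑ x, P x * f x := by
    rw [mul_sum, ← sum_sub_distrib]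
    exact sum_congr rfl fun x _ => by ring
  have hQ2 : ∑ x, P x * (f x - m) ^ 2 =
      (∑ x, P x * (f x) ^ 2) - 2 * m * (∑ x, P x * f x) + m ^ 2 := by
    calc ∑ x, P x * (f x - m) ^ 2
        = ∑ x, (P x * (f x) ^ 2 - 2 * m * (P x * f x) + P x * m ^ 2) :=
          sum_congr rfl fun x _ => by ring
      _ = _ := by
          rw [sum_add_distrib, sum_sub_distrib, ← mul_sum, ← sum_mul, hP1, one_mul]
  set E := ∑ x, P x * f x
  have hratio : ∑ x ∈ univ.filter (fun x => 0 < P x), (P x * (f x - m) / (E - m)) ^ 2 / P x =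
      (∑ x, P x * (f x - m) ^ 2) / (E - m) ^ 2 := by
    rw [sum_filter, sum_div]
    refine sum_congr rfl fun x _ => ?_
    split_ifs with hx
    · have := hx.ne'
      field_simp
    · simp [le_antisymm (not_lt.1 hx) (hP0 x)]
  have hQf' : ∑ x, P x * (f x - m) / (E - m) * f x =
      (∑ x, P x * (f x - m) * f x) / (E - m) := by
    rw [sum_div]
    exact sum_congr rfl fun x _ => by ring
  refine ⟨fun x => P x * (f x - m) / (E - m), fun x => ?_, ?_, fun x hx => by simp [hx], ?_⟩
  · rcases (hP0 x).eq_or_lt with hx | hx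
    · simp [← hx]
    · exact div_nonneg (mul_nonneg hx.le (sub_nonneg.2 (hf x hx))) hμ.le
  · rw [← sum_div, hQ1, div_self hμ0]
  · rw [hratio, hQf', hQ2, hQf]
    field_simp
    ring
end

section
/- Let α be a finite type, let P and Q be probability mass functions on α, let n be a natural number, and let f : α → ℝⁿ be a vector observable with covariance matrix C = E_P[(f − E_P[f])(f − E_P[f])ᵀ]. Define γ = Σ_{x : P(x)>0} Q(x), assume γ > 0, let E_P[(Q/P)²] = Σ_{x : P(x)>0} Q(x)²/P(x), and let v = Σ_{x : P(x)>0} Q(x) f(x) − γ E_P[f] ∈ ℝⁿ. Then the matrix (E_P[(Q/P)²] − γ²) · C − v vᵀ is positive semidefinite. -/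
open Finset

/-- For weights `P` of total mass one, the covariance is the sum of the centred products. -/
lemma sum_mul_centred_mul_centred {ι : Type*} [Fintype ι] {P : ι → ℝ}
    (hP1 : ∑ x, P x = 1) (w g : ι → ℝ) :
    ∑ x, P x * ((w x - ∑ y, P y * w y) * (g x - ∑ y, P y * g y)) =
      ∑ x, P x * (w x * g x) - (∑ x, P x * w x) * ∑ x, P x * g x := by
  set a := ∑ y, P y * w y with ha
  set b := ∑ y, P y * g y with hb
  have h : ∀ x, P x * ((w x - a) * (g x - b)) =
      P x * (w x * g x) - b * (P x * w x) - a * (P x * g x) + a * b * P x := fun x => by ring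
  simp only [h, sum_add_distrib, sum_sub_distrib, ← mul_sum, hP1, ← ha, ← hb]
  ring

/-- The Cauchy–Schwarz inequality for covariances with respect to finite weights. -/
lemma covariance_sq_le {ι : Type*} [Fintype ι] {P : ι → ℝ} (hP0 : ∀ x, 0 ≤ P x)
    (hP1 : ∑ x, P x = 1) (w g : ι → ℝ) :
    (∑ x, P x * (w x * g x) - (∑ x, P x * w x) * ∑ x, P x * g x) ^ 2 ≤
      (∑ x, P x * (w x * w x) - (∑ x, P x * w x) * ∑ x, P x * w x) *
        (∑ x, P x * (g x * g x) - (∑ x, P x * g x) * ∑ x, P x * g x) := by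
  simp only [← sum_mul_centred_mul_centred hP1]
  refine sum_sq_le_sum_mul_sum_of_sq_le_mul _ (fun x _ => ?_) (fun x _ => ?_)
    fun x _ => (by ring : _ = _).le
  · exact mul_nonneg (hP0 x) (mul_self_nonneg _)
  · exact mul_nonneg (hP0 x) (mul_self_nonneg _)

/-- Sums over the support of `P` as expectations of the likelihood ratio `Q / P`. -/
lemma sum_support_mul_eq {ι : Type*} [Fintype ι] {P : ι → ℝ} (hP0 : ∀ x, 0 ≤ P x)
    (Q h : ι → ℝ) :
    ∑ x ∈ univ.filter (fun x => 0 < P x), Q x * h x = ∑ x, P x * (Q x / P x * h x) := by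
  rw [sum_filter]
  refine sum_congr rfl fun x _ => ?_
  split_ifs with hx
  · field_simp
  · simp [le_antisymm (not_lt.mp hx) (hP0 x)]

/-- The Matrix TUR (Theorem 2 of the appendix), in product form:
for a vector observable `f : α → ℝⁿ` with covariance matrix `C`,
`γ = Σ_{P(x)>0} Q(x) > 0`, and
`v = Σ_{P(x)>0} Q(x) f(x) − γ E_P[f]`, the matrix
`(E_P[(Q/P)²] − γ²) • C − v vᵀ` is positive semidefinite. -/
theorem matrix_TUR {α : Type*} [Fintype α] (n : ℕ) (P Q : α → ℝ)
    (f : α → Fin n → ℝ)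
    (hP0 : ∀ x, 0 ≤ P x) (hP1 : ∑ x, P x = 1)
    (hQ0 : ∀ x, 0 ≤ Q x) (hQ1 : ∑ x, Q x = 1)
    (hγ : 0 < ∑ x ∈ univ.filter (fun x => 0 < P x), Q x)
    (C : Matrix (Fin n) (Fin n) ℝ)
    (hC : ∀ i j, C i j = (∑ x, P x * (f x i * f x j)) -
      (∑ x, P x * f x i) * (∑ x, P x * f x j))
    (v : Fin n → ℝ)
    (hv : ∀ i, v i = (∑ x ∈ univ.filter (fun x => 0 < P x), Q x * f x i) -
      (∑ x ∈ univ.filter (fun x => 0 < P x), Q x) * (∑ x, P x * f x i)) :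
    (((∑ x ∈ univ.filter (fun x => 0 < P x), (Q x) ^ 2 / P x) -
        (∑ x ∈ univ.filter (fun x => 0 < P x), Q x) ^ 2) • C -
      Matrix.vecMulVec v v).PosSemidef := by
  have hγ' : ∑ x ∈ univ.filter (fun x => 0 < P x), Q x = ∑ x, P x * (Q x / P x) := by
    simpa using sum_support_mul_eq hP0 Q 1
  have hsq : ∑ x ∈ univ.filter (fun x => 0 < P x), Q x ^ 2 / P x =
      ∑ x, P x * (Q x / P x * (Q x / P x)) := by
    rw [← sum_support_mul_eq hP0 Q fun x => Q x / P x]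
    exact sum_congr rfl fun x _ => by ring
  set m : Fin n → ℝ := ∑ x, P x • f x with hm
  have hC' : C = ∑ x, P x • Matrix.vecMulVec (f x) (f x) - Matrix.vecMulVec m m := by
    ext i j
    simp [hC, hm, Matrix.sum_apply, Matrix.vecMulVec_apply]
  have hv' : v = ∑ x, (P x * (Q x / P x)) • f x - (∑ x, P x * (Q x / P x)) • m := by
    ext i
    rw [hv, hγ', sum_support_mul_eq hP0 Q fun x => f x i]
    simp [hm, mul_assoc]
  rw [hγ', hsq]
  refine Matrix.PosSemidef.of_dotProduct_mulVec_nonneg ?_ fun u => ?_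
  · ext i j
    simp [hC, Matrix.vecMulVec_apply, mul_comm]
  have hum : u ⬝ᵥ m = ∑ x, P x * (u ⬝ᵥ f x) := by
    simp [hm, dotProduct_sum]
  have huv : u ⬝ᵥ v = ∑ x, P x * (Q x / P x * (u ⬝ᵥ f x)) -
      (∑ x, P x * (Q x / P x)) * ∑ x, P x * (u ⬝ᵥ f x) := by
    rw [hv', dotProduct_sub, dotProduct_smul, hum]
    simp [dotProduct_sum, mul_assoc]
  have huC : u ⬝ᵥ C.mulVec u = ∑ x, P x * ((u ⬝ᵥ f x) * (u ⬝ᵥ f x)) -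
      (∑ x, P x * (u ⬝ᵥ f x)) * ∑ x, P x * (u ⬝ᵥ f x) := by
    rw [hC', Matrix.sub_mulVec, dotProduct_sub, ← hum]
    simp [Matrix.sum_mulVec, Matrix.smul_mulVec, Matrix.vecMulVec_mulVec, dotProduct_sum,
      dotProduct_comm _ u]
  have key := covariance_sq_le hP0 hP1 (fun x => Q x / P x) fun x => u ⬝ᵥ f x
  rw [← huv, ← huC] at key
  rw [star_trivial, Matrix.sub_mulVec, Matrix.smul_mulVec, Matrix.vecMulVec_mulVec,
    dotProduct_sub, dotProduct_smul, dotProduct_smul, dotProduct_comm v u]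
  simp only [smul_eq_mul, MulOpposite.smul_eq_mul_unop, MulOpposite.unop_op]
  linarith
end

section
/- Let α be a finite type with an involution * : α → α, let P and P̃ be probability mass functions on α with P̃(x*) > 0 implying P(x) > 0 for every x, and let f : α → ℝ be antisymmetric under reversal: f(x*) = −f(x) for all x. Define E_P[e^{−2ΔS}] = Σ_{x : P(x)>0} P̃(x*)²/P(x). Then Var_P[f] · (E_P[e^{−2ΔS}] − 1) ≥ (E_{P̃}[f] + E_P[f])². -/
open Finset

/-- The generalized TUR (Hammersley–Chapman–Robbins bound) on a finite type. -/
theorem sq_sub_mean_le_variance_mul_chiSq {α : Type*} [Fintype α] (P Q f : α → ℝ)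
    (hP0 : ∀ x, 0 ≤ P x) (hP1 : ∑ x, P x = 1) (hQ1 : ∑ x, Q x = 1)
    (hac : ∀ x, P x = 0 → Q x = 0) :
    ((∑ x, Q x * f x) - ∑ x, P x * f x) ^ 2 ≤
      ((∑ x, P x * (f x) ^ 2) - (∑ x, P x * f x) ^ 2) * ((∑ x, (Q x) ^ 2 / P x) - 1) := by
  set m := ∑ x, P x * f x with hm
  have hcs := sum_sq_le_sum_mul_sum_of_sq_le_mul univ
    (r := fun x => (f x - m) * (Q x - P x)) (f := fun x => P x * (f x - m) ^ 2)
    (g := fun x => (Q x - P x) ^ 2 / P x)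
    (fun x _ => mul_nonneg (hP0 x) (sq_nonneg _))
    (fun x _ => div_nonneg (sq_nonneg _) (hP0 x))
    (fun x _ => le_of_eq <| by
      by_cases h : P x = 0
      · simp [h, hac x h]
      · field_simp)
  have hcov : ∑ x, (f x - m) * (Q x - P x) = (∑ x, Q x * f x) - m := by
    have h : ∀ x, (f x - m) * (Q x - P x) = Q x * f x - P x * f x - m * Q x + m * P x :=
      fun x => by ring
    simp only [h, sum_add_distrib, sum_sub_distrib, ← mul_sum, hP1, hQ1, ← hm]
    ring
  have hvar : ∑ x, P x * (f x - m) ^ 2 = (∑ x, P x * (f x) ^ 2) - m ^ 2 := by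
    have h : ∀ x, P x * (f x - m) ^ 2 = P x * (f x) ^ 2 - 2 * m * (P x * f x) + m ^ 2 * P x :=
      fun x => by ring
    simp only [h, sum_add_distrib, sum_sub_distrib, ← mul_sum, hP1, ← hm]
    ring
  have hchi : ∑ x, (Q x - P x) ^ 2 / P x = (∑ x, (Q x) ^ 2 / P x) - 1 := by
    have h : ∀ x, (Q x - P x) ^ 2 / P x = (Q x) ^ 2 / P x - 2 * Q x + P x := fun x => by
      by_cases h : P x = 0
      · simp [h, hac x h]
      · field_simp
        ring
    simp only [h, sum_add_distrib, sum_sub_distrib, ← mul_sum, hP1, hQ1]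
    ring
  rwa [hcov, hvar, hchi] at hcs

/-- The TUR for antisymmetric currents (γ = 1 case): for forward and reversed
path distributions `P`, `P̃` with reversal involution `σ`, and an antisymmetric
observable `f(σ x) = −f(x)`,
`Var_P[f] · (E_P[e^{−2ΔS}] − 1) ≥ (E_{P̃}[f] + E_P[f])²`. -/
theorem antisymmetric_current_TUR {α : Type*} [Fintype α] (σ : α → α)
    (hσ : ∀ x, σ (σ x) = x)
    (P Pt : α → ℝ) (f : α → ℝ)
    (hP0 : ∀ x, 0 ≤ P x) (hP1 : ∑ x, P x = 1)
    (hPt0 : ∀ x, 0 ≤ Pt x) (hPt1 : ∑ x, Pt x = 1)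
    (hac : ∀ x, 0 < Pt (σ x) → 0 < P x)
    (hf : ∀ x, f (σ x) = -f x) :
    ((∑ x, P x * (f x) ^ 2) - (∑ x, P x * f x) ^ 2) *
      ((∑ x ∈ univ.filter (fun x => 0 < P x), (Pt (σ x)) ^ 2 / P x) - 1) ≥
      ((∑ x, Pt x * f x) + (∑ x, P x * f x)) ^ 2 := by
  have hσb : Function.Bijective σ := Function.Involutive.bijective hσ
  have hQ1 : ∑ x, Pt (σ x) = 1 := by
    rw [hσb.sum_comp Pt, hPt1]
  have hQf : ∑ x, Pt (σ x) * f x = -∑ x, Pt x * f x := by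
    rw [← hσb.sum_comp (fun x => Pt x * f x), ← sum_neg_distrib]
    simp [hf]
  have hQ0 : ∀ x, P x = 0 → Pt (σ x) = 0 := fun x hx =>
    le_antisymm (not_lt.mp fun h => (hac x h).ne' hx) (hPt0 _)
  have hsum : ∑ x ∈ univ.filter (fun x => 0 < P x), (Pt (σ x)) ^ 2 / P x =
      ∑ x, (Pt (σ x)) ^ 2 / P x := by
    refine sum_filter_of_ne fun x _ hx => (hP0 x).lt_of_ne' fun h => hx ?_
    simp [h]
  have key := sq_sub_mean_le_variance_mul_chiSq P (fun x => Pt (σ x)) f hP0 hP1 hQ1 hQ0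
  rw [hQf] at key
  rw [hsum, ge_iff_le]
  refine le_trans (le_of_eq ?_) key
  ring
end

section
/- Let α be a finite type with an involution * : α → α, let P and P̃ be probability mass functions on α with P̃(x*) > 0 implying P(x) > 0 for every x, and let f : α → ℝ satisfy f(x*) = −f(x) for all x. Define E_{P̃}[e^{ΔS_rev}] = Σ_{x : P̃(x)>0} P̃(x)²/P(x*). Then Var_P[f] · (E_{P̃}[e^{ΔS_rev}] − 1) ≥ (E_{P̃}[f] + E_P[f])². -/
open Finset

/-- The Hammersley–Chapman–Robbins inequality for probability mass functions `Q ≪ P` on a finite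
type. -/
theorem sq_sum_sub_sum_le_variance_mul_chiSq {α : Type*} [Fintype α] (P Q f : α → ℝ)
    (hP0 : ∀ x, 0 ≤ P x) (hP1 : ∑ x, P x = 1) (hQ1 : ∑ x, Q x = 1)
    (hac : ∀ x, P x = 0 → Q x = 0) :
    ((∑ x, Q x * f x) - ∑ x, P x * f x) ^ 2 ≤
      ((∑ x, P x * f x ^ 2) - (∑ x, P x * f x) ^ 2) * ((∑ x, Q x ^ 2 / P x) - 1) := by
  set m := ∑ x, P x * f x with hm
  have hcov : ∑ x, (Q x - P x) * (f x - m) = (∑ x, Q x * f x) - m := by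
    have h : ∀ x, (Q x - P x) * (f x - m) = Q x * f x - P x * f x - Q x * m + P x * m :=
      fun x => by ring
    simp only [h, sum_add_distrib, sum_sub_distrib, ← sum_mul, hP1, hQ1, ← hm]
    ring
  have hvar : ∑ x, P x * (f x - m) ^ 2 = (∑ x, P x * f x ^ 2) - m ^ 2 := by
    have h : ∀ x, P x * (f x - m) ^ 2 = P x * f x ^ 2 - P x * f x * (2 * m) + P x * m ^ 2 :=
      fun x => by ring
    simp only [h, sum_add_distrib, sum_sub_distrib, ← sum_mul, hP1, ← hm]
    ring
  have hchi : ∑ x, (Q x - P x) ^ 2 / P x = (∑ x, Q x ^ 2 / P x) - 1 := by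
    have h : ∀ x, (Q x - P x) ^ 2 / P x = Q x ^ 2 / P x - Q x * 2 + P x := fun x => by
      rcases eq_or_ne (P x) 0 with h0 | h0
      · simp [h0, hac x h0]
      · field_simp
        ring
    simp only [h, sum_add_distrib, sum_sub_distrib, ← sum_mul, hP1, hQ1]
    ring
  rw [← hcov, ← hvar, ← hchi]
  refine sum_sq_le_sum_mul_sum_of_sq_le_mul univ
    (fun x _ => mul_nonneg (hP0 x) (sq_nonneg _))
    (fun x _ => div_nonneg (sq_nonneg _) (hP0 x)) fun x _ => le_of_eq ?_
  rcases eq_or_ne (P x) 0 with h0 | h0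
  · simp [h0, hac x h0]
  · field_simp

/-- The antisymmetric-current TUR expressed via the reversed entropy production:
`Var_P[f] · (E_{P̃}[e^{ΔS_rev}] − 1) ≥ (E_{P̃}[f] + E_P[f])²`, where
`E_{P̃}[e^{ΔS_rev}] = Σ_{x : P̃(x)>0} P̃(x)²/P(σ x)`. -/
theorem antisymmetric_current_TUR_rev {α : Type*} [Fintype α] (σ : α → α)
    (hσ : ∀ x, σ (σ x) = x)
    (P Pt : α → ℝ) (f : α → ℝ)
    (hP0 : ∀ x, 0 ≤ P x) (hP1 : ∑ x, P x = 1)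
    (hPt0 : ∀ x, 0 ≤ Pt x) (hPt1 : ∑ x, Pt x = 1)
    (hac : ∀ x, 0 < Pt (σ x) → 0 < P x)
    (hf : ∀ x, f (σ x) = -f x) :
    ((∑ x, P x * (f x) ^ 2) - (∑ x, P x * f x) ^ 2) *
      ((∑ x ∈ univ.filter (fun x => 0 < Pt x), (Pt x) ^ 2 / P (σ x)) - 1) ≥
      ((∑ x, Pt x * f x) + (∑ x, P x * f x)) ^ 2 := by
  have hσ' : Function.Involutive σ := hσ
  have hsum (g : α → ℝ) : ∑ x, g (σ x) = ∑ x, g x := Equiv.sum_comp hσ'.toPerm g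
  have hcur : ∑ x, Pt (σ x) * f x = -∑ x, Pt x * f x := by
    rw [← hsum fun x => Pt x * f x, ← sum_neg_distrib]
    simp [hf]
  have hchi : ∑ x ∈ univ.filter (fun x => 0 < Pt x), Pt x ^ 2 / P (σ x) =
      ∑ x, Pt (σ x) ^ 2 / P x := by
    rw [← hsum fun x => Pt (σ x) ^ 2 / P x]
    simp only [hσ]
    refine sum_filter_of_ne fun x _ hx => (hPt0 x).lt_of_ne' fun h0 => hx ?_
    simp [h0]
  have key := sq_sum_sub_sum_le_variance_mul_chiSq P (fun x => Pt (σ x)) f hP0 hP1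
    ((hsum Pt).trans hPt1) fun x h0 =>
      le_antisymm (not_lt.mp fun h => (hac x h).ne' h0) (hPt0 _)
  rw [hcur] at key
  rw [hchi, ge_iff_le]
  convert key using 1
  ring
end

section
/- Let α be a finite type with an involution * : α → α, let P be a probability mass function on α whose support is invariant under * (P(x) > 0 implies P(x*) > 0), and let f : α → ℝ satisfy f(x*) = −f(x) for all x. Define E_P[e^{ΔS}] = Σ_{x : P(x)>0} P(x)²/P(x*). Then Var_P[f] · (E_P[e^{ΔS}] − 1) ≥ 4 (E_P[f])². -/
open Finset

/-- The steady-state current bound `Var[f] · (⟨e^{ΔS}⟩ − 1) ≥ 4⟨f⟩²`: for a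
path distribution `P` whose support is invariant under the reversal involution
`σ` and an antisymmetric observable `f(σ x) = −f(x)`,
`Var_P[f] · (Σ_{x : P(x)>0} P(x)²/P(σ x) − 1) ≥ 4 (E_P[f])²`. -/
theorem steady_state_current_TUR {α : Type*} [Fintype α] (σ : α → α)
    (hσ : ∀ x, σ (σ x) = x)
    (P : α → ℝ) (f : α → ℝ)
    (hP0 : ∀ x, 0 ≤ P x) (hP1 : ∑ x, P x = 1)
    (hsupp : ∀ x, 0 < P x → 0 < P (σ x))
    (hf : ∀ x, f (σ x) = -f x) :
    ((∑ x, P x * (f x) ^ 2) - (∑ x, P x * f x) ^ 2) *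
      ((∑ x ∈ univ.filter (fun x => 0 < P x), (P x) ^ 2 / P (σ x)) - 1) ≥
      4 * (∑ x, P x * f x) ^ 2 := by
  have sum_comp (g : α → ℝ) : ∑ x, g (σ x) = ∑ x, g x :=
    Function.Bijective.sum_comp (Function.Involutive.bijective hσ) g
  have P_eq_zero : ∀ x, P (σ x) = 0 → P x = 0 := fun x h => by
    by_contra hne
    exact (hsupp x (lt_of_le_of_ne (hP0 x) (Ne.symm hne))).ne' h
  set m := ∑ x, P x * f x with hm
  have sum_rev : ∑ x, P (σ x) = 1 := (sum_comp P).trans hP1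
  have mean_rev : ∑ x, P (σ x) * f x = -m := by
    rw [hm, ← sum_comp, ← sum_neg_distrib]
    exact sum_congr rfl fun x _ => by rw [hf, hσ]; ring
  have sq_rev : ∑ x, P (σ x) * f x ^ 2 = ∑ x, P x * f x ^ 2 := by
    rw [← sum_comp (fun x => P x * f x ^ 2)]
    exact sum_congr rfl fun x _ => by rw [hf]; ring
  have var_rev : ∑ x, P (σ x) * (f x + m) ^ 2 = (∑ x, P x * f x ^ 2) - m ^ 2 := by
    calc ∑ x, P (σ x) * (f x + m) ^ 2
        = ∑ x, (P (σ x) * f x ^ 2 + 2 * m * (P (σ x) * f x) + m ^ 2 * P (σ x)) :=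
          sum_congr rfl fun x _ => by ring
      _ = (∑ x, P x * f x ^ 2) - m ^ 2 := by
          rw [sum_add_distrib, sum_add_distrib, ← mul_sum, ← mul_sum, sq_rev, mean_rev, sum_rev]
          ring
  have chi_sq : ∑ x, (P x - P (σ x)) ^ 2 / P (σ x) =
      (∑ x ∈ univ.filter (fun x => 0 < P x), (P x) ^ 2 / P (σ x)) - 1 := by
    have full : ∑ x ∈ univ.filter (fun x => 0 < P x), (P x) ^ 2 / P (σ x) =
        ∑ x, (P x) ^ 2 / P (σ x) := by
      refine sum_filter_of_ne fun x _ h => lt_of_le_of_ne (hP0 x) fun h0 => h ?_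
      simp [← h0]
    calc ∑ x, (P x - P (σ x)) ^ 2 / P (σ x)
        = ∑ x, ((P x) ^ 2 / P (σ x) - 2 * P x + P (σ x)) := by
          refine sum_congr rfl fun x _ => ?_
          by_cases h : P (σ x) = 0
          · simp [h, P_eq_zero x h]
          · field_simp
            ring
      _ = _ := by
          rw [sum_add_distrib, sum_sub_distrib, ← mul_sum, hP1, sum_rev, full]
          ring
  have mean_diff : ∑ x, (P x - P (σ x)) * (f x + m) = 2 * m := by
    calc ∑ x, (P x - P (σ x)) * (f x + m)
        = ∑ x, (P x * f x - P (σ x) * f x + m * P x - m * P (σ x)) :=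
          sum_congr rfl fun x _ => by ring
      _ = 2 * m := by
          rw [sum_sub_distrib, sum_add_distrib, sum_sub_distrib, ← mul_sum, ← mul_sum,
            mean_rev, hP1, sum_rev, ← hm]
          ring
  have cauchy_schwarz : (∑ x, (P x - P (σ x)) * (f x + m)) ^ 2 ≤
      (∑ x, P (σ x) * (f x + m) ^ 2) * ∑ x, (P x - P (σ x)) ^ 2 / P (σ x) := by
    refine sum_sq_le_sum_mul_sum_of_sq_le_mul univ
      (fun x _ => mul_nonneg (hP0 _) (sq_nonneg _))
      (fun x _ => div_nonneg (sq_nonneg _) (hP0 _)) fun x _ => le_of_eq ?_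
    by_cases h : P (σ x) = 0
    · simp [h, P_eq_zero x h]
    · field_simp
  rw [mean_diff, var_rev, chi_sq] at cauchy_schwarz
  linarith
end

section
/- Let α be a finite type, let P be a probability mass function on α, let f : α → ℝ satisfy f(x) ≥ 0 whenever P(x) > 0, and suppose Z := E_P[f] > 0. Define Q(x) = f(x) P(x) / Z and e^R(x) = Q(x)/P(x) on the support of P (set to 0 off the support). Then cov_P(f, e^R) = Z · Var_P[e^R], and consequently E_Q[f] − E_P[f] = Z · Var_P[e^R]. -/
open Finset

/-- Second intermediate identity in the optimality proof: with `Z = E_P[f] > 0`,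
`Q = fP/Z`, and `e^R = Q/P` on the support of `P` (0 elsewhere),
`cov_P(f, e^R) = Z · Var_P[e^R]` and `E_Q[f] − E_P[f] = Z · Var_P[e^R]`. -/
theorem covariance_tilted_identity {α : Type*} [Fintype α] (P : α → ℝ) (f : α → ℝ)
    (hP0 : ∀ x, 0 ≤ P x) (hP1 : ∑ x, P x = 1)
    (hf : ∀ x, 0 < P x → 0 ≤ f x)
    (hZ : 0 < ∑ x, P x * f x)
    (Q : α → ℝ) (hQ : ∀ x, Q x = f x * P x / (∑ y, P y * f y))
    (eR : α → ℝ) (heR : ∀ x, eR x = if 0 < P x then Q x / P x else 0) :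
    ((∑ x, P x * (f x * eR x)) - (∑ x, P x * f x) * (∑ x, P x * eR x) =
      (∑ x, P x * f x) *
        ((∑ x, P x * (eR x) ^ 2) - (∑ x, P x * eR x) ^ 2)) ∧
    ((∑ x, Q x * f x) - (∑ x, P x * f x) =
      (∑ x, P x * f x) *
        ((∑ x, P x * (eR x) ^ 2) - (∑ x, P x * eR x) ^ 2)) := by
  set Z := ∑ x, P x * f x with hZdef
  have hQR : ∀ x, Q x = P x * eR x := by
    intro x
    rw [heR]
    split_ifs with h
    · rw [mul_div_cancel₀ _ h.ne']
    · have hPx : P x = 0 := le_antisymm (not_lt.mp h) (hP0 x)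
      simp [hQ, hPx]
  have hfR : ∀ x, P x * f x = Z * (P x * eR x) := by
    intro x
    rw [← hQR, hQ, mul_div_cancel₀ _ hZ.ne', mul_comm]
  have hmean : ∑ x, P x * eR x = 1 := by
    have h : Z * ∑ x, P x * eR x = Z * 1 := by
      rw [mul_sum, mul_one, hZdef]
      exact sum_congr rfl fun x _ => (hfR x).symm
    exact mul_left_cancel₀ hZ.ne' h
  have hcross : ∑ x, P x * (f x * eR x) = Z * ∑ x, P x * (eR x) ^ 2 := by
    rw [mul_sum]
    refine sum_congr rfl fun x _ => ?_
    linear_combination eR x * hfR x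
  have hQf : ∑ x, Q x * f x = ∑ x, P x * (f x * eR x) :=
    sum_congr rfl fun x _ => by rw [hQR]; ring
  rw [hQf, hcross, hmean]
  constructor <;> ring
end
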